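/- Let n ≥ 1 and let v₀, …, vₙ ∈ ℝⁿ be affinely independent, and let T = convexHull{v₀, …, vₙ} be the corresponding geometric n-simplex. Then there exist 2ⁿ subsets U₁, …, U_{2ⁿ} of ℝⁿ (the Freudenthal subdivision of T) such that: (i) each U_m is the convex hull of n+1 affinely independent points, each of which is a midpoint (v_i + v_j)/2 for some 0 ≤ i ≤ j ≤ n; (ii) T = U₁ ∪ … ∪ U_{2ⁿ}; (iii) the topological interiors of distinct U_m are pairwise disjoint; and (iv) every U_m has the same n-dimensional Lebesgue measure, equal to 2^{−n} times the Lebesgue measure of T. -/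

import Mathlib

open MeasureTheory

/-- The vertices `(1, …, 1, 0, …, 0)` of the simplex `1 ≥ z₀ ≥ ⋯ ≥ z_{n-1} ≥ 0`. -/
def kuhnVertex {n : ℕ} (k : Fin (n + 1)) : Fin n → ℝ := fun j => if (j : ℕ) < k then 1 else 0

/-- The linear map sending the `j`-th unit vector to the edge `v (j + 1) - v j`. -/
noncomputable def edgeMap {n : ℕ} (v : Fin (n + 1) → (Fin n → ℝ)) :
    (Fin n → ℝ) →ₗ[ℝ] (Fin n → ℝ) :=
  Fintype.linearCombination ℝ fun j : Fin n => v j.succ - v j.castSucc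

theorem add_edgeMap_kuhnVertex {n : ℕ} (v : Fin (n + 1) → (Fin n → ℝ)) (k : Fin (n + 1)) :
    v 0 + edgeMap v (kuhnVertex k) = v k := by
  induction k using Fin.induction with
  | zero =>
    have h : kuhnVertex (0 : Fin (n + 1)) = 0 := by ext j; simp [kuhnVertex]
    simp [h]
  | succ k ih =>
    have h : kuhnVertex k.succ = kuhnVertex k.castSucc + Pi.single k 1 := by
      ext j
      simp only [kuhnVertex, Pi.add_apply, Pi.single_apply, Fin.ext_iff, Fin.val_succ,
        Fin.val_castSucc]
      split_ifs <;> first | omega | norm_num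
    rw [h, map_add, ← add_assoc, ih]
    simp [edgeMap]

theorem convexHull_range_add_linearMap {ι E F : Type*} [AddCommGroup E] [Module ℝ E]
    [AddCommGroup F] [Module ℝ F] (c : F) (M : E →ₗ[ℝ] F) (p : ι → E) :
    convexHull ℝ (Set.range fun k => c + M (p k)) =
      (fun z => c + M z) '' convexHull ℝ (Set.range p) := by
  have h := AffineMap.image_convexHull (AffineMap.const ℝ E c + M.toAffineMap) (Set.range p)
  rw [← Set.range_comp] at h
  exact h.symm

theorem volume_convexHull_range_add_linearMap {ι : Type*} {n : ℕ} (c : Fin n → ℝ)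
    (M : (Fin n → ℝ) →ₗ[ℝ] (Fin n → ℝ)) (p : ι → Fin n → ℝ) :
    volume (convexHull ℝ (Set.range fun k => c + M (p k))) =
      ENNReal.ofReal |LinearMap.det M| * volume (convexHull ℝ (Set.range p)) := by
  rw [convexHull_range_add_linearMap, ← Measure.addHaar_image_linearMap volume M,
    ← Set.image_image (fun y => c + y) M, Set.image_add_left, measure_preimage_add]

theorem kuhn_bounds {n : ℕ} {z : Fin n → ℝ}
    (hz : z ∈ convexHull ℝ (Set.range (kuhnVertex (n := n)))) :
    Antitone z ∧ ∀ j, z j ∈ Set.Icc (0 : ℝ) 1 := by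
  have hc : Convex ℝ {z : Fin n → ℝ | Antitone z ∧ ∀ j, z j ∈ Set.Icc (0 : ℝ) 1} := by
    rintro x ⟨hx, hx'⟩ y ⟨hy, hy'⟩ a b ha hb hab
    refine ⟨(hx.const_smul ha).add (hy.const_smul hb) , fun j => ?_⟩
    exact convex_Icc (0 : ℝ) 1 (hx' j) (hy' j) ha hb hab
  refine convexHull_min ?_ hc hz
  rintro _ ⟨k, rfl⟩
  refine ⟨fun i j hij => ?_, fun j => ?_⟩
  · have : (i : ℕ) ≤ j := hij
    simp only [kuhnVertex]
    split_ifs <;> first | omega | norm_num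
  · simp only [kuhnVertex]
    split_ifs <;> norm_num

theorem mem_convexHull_kuhnVertex {n : ℕ} {z : Fin n → ℝ} (hz : Antitone z)
    (hz' : ∀ j, z j ∈ Set.Icc (0 : ℝ) 1) :
    z ∈ convexHull ℝ (Set.range (kuhnVertex (n := n))) := by
  let Z : ℕ → ℝ := fun k => if k = 0 then 1 else if h : k - 1 < n then z ⟨k - 1, h⟩ else 0
  have hZ : Antitone Z := by
    refine antitone_nat_of_succ_le fun k => ?_
    rcases k with _ | k
    · simp only [Z]
      split_ifs <;> first | omega | simp [(hz' _).2]
    · simp only [Z, Nat.add_sub_cancel]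
      split_ifs <;> first | omega | exact le_rfl | exact (hz' _).1 | exact hz (by simp)
  have hsum (m : ℕ) (hm : m ≤ n + 1) :
      ∑ k : Fin (n + 1), (if m ≤ (k : ℕ) then Z k - Z (k + 1) else 0) = Z m := by
    rw [Fin.sum_univ_eq_sum_range (fun k => if m ≤ k then Z k - Z (k + 1) else 0),
      ← Finset.sum_filter]
    have : {k ∈ Finset.range (n + 1) | m ≤ k} = Finset.Ico m (n + 1) := by ext; simp; omega
    rw [this, Finset.sum_Ico_eq_sub _ hm, Finset.sum_range_sub', Finset.sum_range_sub']
    simp [Z]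
  refine mem_convexHull_of_exists_fintype (fun k : Fin (n + 1) => Z k - Z (k + 1)) kuhnVertex
    (fun k => sub_nonneg.2 (hZ (Nat.le_succ _))) (by simpa [Z] using hsum 0 (Nat.zero_le _))
    (fun k => Set.mem_range_self k) ?_
  ext j
  have h := hsum (j + 1) (by omega)
  simp only [Finset.sum_apply, Pi.smul_apply, kuhnVertex, smul_eq_mul, mul_ite, mul_one, mul_zero]
  simpa [Z, Nat.succ_le_iff] using h

/-- The number of elements of `S` below `k`. -/
def countBelow {n : ℕ} (S : Finset (Fin n)) (k : ℕ) : ℕ :=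
  (S.filter fun j : Fin n => (j : ℕ) < k).card

theorem countBelow_le {n : ℕ} (S : Finset (Fin n)) (k : ℕ) : countBelow S k ≤ S.card :=
  Finset.card_filter_le _ _

theorem countBelow_lt_iff {n : ℕ} {S : Finset (Fin n)} {m : Fin n} (hm : m ∈ S) (k : ℕ) :
    countBelow S m < countBelow S k ↔ (m : ℕ) < k := by
  constructor
  · intro h
    by_contra! hk
    refine h.not_ge (Finset.card_le_card fun j => ?_)
    simp only [Finset.mem_filter]
    exact fun hj => ⟨hj.1, hj.2.trans_le hk⟩
  · intro h
    refine Finset.card_lt_card (Finset.ssubset_iff_of_subset (fun j => ?_) |>.2 ⟨m, ?_, ?_⟩)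
    · simp only [Finset.mem_filter]
      exact fun hj => ⟨hj.1, hj.2.trans h⟩
    · simp [hm, h]
    · simp

theorem countBelow_lt_card {n : ℕ} {S : Finset (Fin n)} {m : Fin n} (hm : m ∈ S) :
    countBelow S m < S.card :=
  ((countBelow_lt_iff hm n).2 m.2).trans_le (countBelow_le S n)

/-- The coordinate changed in the `k`-th step of the monotone path encoded by `S`: steps in `S`
run through the first `S.card` coordinates, the other steps through the remaining ones. -/
def stepIndex {n : ℕ} (S : Finset (Fin n)) (k : Fin n) : ℕ :=
  if k ∈ S then countBelow S k else S.card + countBelow Sᶜ k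

theorem stepIndex_lt_card_iff {n : ℕ} (S : Finset (Fin n)) (k : Fin n) :
    stepIndex S k < S.card ↔ k ∈ S := by
  unfold stepIndex
  split_ifs with h
  · simp [h, countBelow_lt_card h]
  · simp [h]

theorem card_add_card_compl_fin {n : ℕ} (S : Finset (Fin n)) : S.card + Sᶜ.card = n := by
  simp

theorem stepIndex_lt {n : ℕ} (S : Finset (Fin n)) (k : Fin n) : stepIndex S k < n := by
  have hS := card_add_card_compl_fin S
  unfold stepIndex
  split_ifs with h
  · have := countBelow_lt_card h
    omega
  · have := countBelow_lt_card (Finset.mem_compl.2 h)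
    omega

theorem stepIndex_injective {n : ℕ} (S : Finset (Fin n)) : Function.Injective (stepIndex S) := by
  have aux (R : Finset (Fin n)) {k l : Fin n} (hk : k ∈ R) (hl : l ∈ R)
      (h : countBelow R k = countBelow R l) : k = l := by
    have h₁ := countBelow_lt_iff hk l
    have h₂ := countBelow_lt_iff hl k
    omega
  intro k l h
  have hkl : k ∈ S ↔ l ∈ S := by rw [← stepIndex_lt_card_iff, h, stepIndex_lt_card_iff]
  unfold stepIndex at h
  by_cases hk : k ∈ S
  · have hl := hkl.1 hk
    rw [if_pos hk, if_pos hl] at h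
    exact aux S hk hl h
  · have hl := fun hl => hk (hkl.2 hl)
    rw [if_neg hk, if_neg hl] at h
    exact aux Sᶜ (Finset.mem_compl.2 hk) (Finset.mem_compl.2 hl) (by omega)

/-- The permutation of the coordinates given by `stepIndex`. -/
noncomputable def stepPerm {n : ℕ} (S : Finset (Fin n)) : Equiv.Perm (Fin n) :=
  Equiv.ofBijective (fun k => ⟨stepIndex S k, stepIndex_lt S k⟩)
    (Finite.injective_iff_bijective.1 fun _ _ h =>
      stepIndex_injective S (congrArg Fin.val h))

theorem val_stepPerm {n : ℕ} (S : Finset (Fin n)) (k : Fin n) :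
    (stepPerm S k : ℕ) = stepIndex S k := rfl

theorem stepPerm_eq {n : ℕ} {S : Finset (Fin n)} {σ : Equiv.Perm (Fin n)}
    (hσ : ∀ k l, k < l → (k ∈ S ↔ l ∈ S) → σ k < σ l)
    (hS : ∀ k l, k ∈ S → l ∉ S → σ k < σ l) : stepPerm S = σ := by
  have hlt (k l : Fin n) (hkl : k ∈ S ↔ l ∈ S) : σ k < σ l ↔ k < l := by
    refine ⟨fun h => ?_, fun h => hσ k l h hkl⟩
    rcases lt_trichotomy k l with h' | rfl | h'
    · exact h'
    · exact absurd h (lt_irrefl _)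
    · exact absurd h (hσ l k h' hkl.symm).not_gt
  ext k
  have hcard : (σ k : ℕ) = (Finset.univ.filter fun l => σ l < σ k).card := by
    rw [← Fin.card_Iio (σ k), ← Finset.card_map σ.symm.toEmbedding]
    congr 1
    ext j
    simp [Finset.mem_map_equiv]
  rw [val_stepPerm, hcard, stepIndex]
  split_ifs with hk
  · refine congrArg Finset.card ?_
    ext l
    by_cases hl : l ∈ S
    · simp [hl, hlt l k (by simp [hl, hk])]
    · simp [hl, (hS k l hk hl).le]
  · rw [countBelow, ← Finset.card_union_of_disjoint]
    · refine congrArg Finset.card ?_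
      ext l
      by_cases hl : l ∈ S
      · simp [hl, hS l k hl hk]
      · simp [hl, hlt l k (by simp [hl, hk])]
    · exact (disjoint_compl_right (a := S)).mono_right (Finset.filter_subset _ _)

/-- The point of the monotone path encoded by `S` after `k` steps. -/
noncomputable def freudenthalVertex {n : ℕ} (v : Fin (n + 1) → (Fin n → ℝ))
    (S : Finset (Fin n)) (k : Fin (n + 1)) : Fin n → ℝ :=
  midpoint ℝ
    (v ⟨countBelow S k, by
      have := countBelow_le S k; have := card_add_card_compl_fin S; omega⟩)
    (v ⟨S.card + countBelow Sᶜ k, by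
      have := countBelow_le Sᶜ k; have := card_add_card_compl_fin S; omega⟩)

/-- The vertex of the Kuhn simplex `v_i` with `i = S.card`. -/
def pivotVertex {n : ℕ} (S : Finset (Fin n)) : Fin n → ℝ :=
  kuhnVertex ⟨S.card, by have := card_add_card_compl_fin S; omega⟩

/-- The linear part of the affine map from the Kuhn simplex onto its piece indexed by `S`. -/
noncomputable def pieceMap {n : ℕ} (S : Finset (Fin n)) : (Fin n → ℝ) →ₗ[ℝ] (Fin n → ℝ) :=
  (2⁻¹ : ℝ) • Matrix.toLin' ((stepPerm S)⁻¹.permMatrix ℝ)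

theorem pieceMap_apply_stepPerm {n : ℕ} (S : Finset (Fin n)) (u : Fin n → ℝ) (m : Fin n) :
    pieceMap S u (stepPerm S m) = 2⁻¹ * u m := by
  simp [pieceMap, Matrix.permMatrix_mulVec]

theorem abs_det_pieceMap {n : ℕ} (S : Finset (Fin n)) :
    |LinearMap.det (pieceMap S)| = (2⁻¹ : ℝ) ^ n := by
  rw [pieceMap, LinearMap.det_smul, LinearMap.det_toLin', Matrix.det_permutation, abs_mul]
  rcases Int.units_eq_one_or (Equiv.Perm.sign (stepPerm S)⁻¹) with h | h <;> simp [h]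

theorem freudenthalVertex_eq {n : ℕ} (v : Fin (n + 1) → (Fin n → ℝ))
    (S : Finset (Fin n)) (k : Fin (n + 1)) :
    freudenthalVertex v S k =
      (v 0 + edgeMap v ((2⁻¹ : ℝ) • pivotVertex S)) +
        (edgeMap v ∘ₗ pieceMap S) (kuhnVertex k) := by
  have hmid (x y : Fin n → ℝ) : midpoint ℝ (v 0 + edgeMap v x) (v 0 + edgeMap v y) =
      v 0 + edgeMap v ((2⁻¹ : ℝ) • (x + y)) := by
    rw [midpoint_eq_smul_add, map_smul, map_add]
    simp only [invOf_eq_inv]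
    module
  rw [freudenthalVertex, ← add_edgeMap_kuhnVertex v, ← add_edgeMap_kuhnVertex v ⟨S.card + _, _⟩,
    hmid, add_assoc, LinearMap.comp_apply, ← map_add]
  congr 2
  ext j
  obtain ⟨m, rfl⟩ := (stepPerm S).surjective j
  rw [Pi.add_apply, pieceMap_apply_stepPerm, Pi.smul_apply, Pi.smul_apply, Pi.add_apply,
    smul_eq_mul, smul_eq_mul, ← mul_add]
  congr 1
  simp only [pivotVertex, kuhnVertex, val_stepPerm, stepIndex_lt_card_iff]
  unfold stepIndex
  by_cases hm : m ∈ S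
  · have h₁ := countBelow_lt_iff hm k
    have h₂ := countBelow_lt_card hm
    have h₃ : countBelow S m < S.card + countBelow Sᶜ k := by omega
    simp only [hm, h₁, h₃, if_true]
    exact add_comm _ _
  · have h₁ := countBelow_lt_iff (Finset.mem_compl.2 hm) k
    have h₂ := countBelow_le S k
    have h₃ : ¬ S.card + countBelow Sᶜ m < countBelow S k := by omega
    simp [hm, h₁, h₃]

theorem volume_convexHull_freudenthalVertex {n : ℕ} (v : Fin (n + 1) → (Fin n → ℝ))
    (S : Finset (Fin n)) :
    volume (convexHull ℝ (Set.range (freudenthalVertex v S))) =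
      volume (convexHull ℝ (Set.range v)) / 2 ^ n := by
  have hv : v = fun k => v 0 + edgeMap v (kuhnVertex k) :=
    funext fun k => (add_edgeMap_kuhnVertex v k).symm
  have h₁ := volume_convexHull_range_add_linearMap (v 0) (edgeMap v) (kuhnVertex (n := n))
  rw [← hv] at h₁
  rw [funext (freudenthalVertex_eq v S), volume_convexHull_range_add_linearMap, h₁,
    LinearMap.det_comp, abs_mul, abs_det_pieceMap, ENNReal.ofReal_mul (abs_nonneg _),
    ENNReal.ofReal_pow (by norm_num), ENNReal.ofReal_inv_of_pos two_pos, ENNReal.div_eq_inv_mul,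
    ENNReal.inv_pow, ENNReal.ofReal_ofNat]
  ring

theorem convexHull_freudenthalVertex_subset {n : ℕ} (v : Fin (n + 1) → (Fin n → ℝ))
    (S : Finset (Fin n)) :
    convexHull ℝ (Set.range (freudenthalVertex v S)) ⊆ convexHull ℝ (Set.range v) := by
  refine convexHull_min ?_ (convex_convexHull ℝ _)
  rintro _ ⟨k, rfl⟩
  exact (convex_convexHull ℝ _).midpoint_mem (subset_convexHull ℝ _ (Set.mem_range_self _))
    (subset_convexHull ℝ _ (Set.mem_range_self _))

theorem exists_eq_pivotVertex_add_pieceMap {n : ℕ} {z : Fin n → ℝ}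
    (hz : z ∈ convexHull ℝ (Set.range (kuhnVertex (n := n)))) :
    ∃ S : Finset (Fin n), ∃ u ∈ convexHull ℝ (Set.range (kuhnVertex (n := n))),
      z = (2⁻¹ : ℝ) • pivotVertex S + pieceMap S u := by
  obtain ⟨hanti, hIcc⟩ := kuhn_bounds hz
  let f : Fin n → ℝ := fun j => (if 1 ≤ 2 * z j then 1 else 0) - 2 * z j
  let σ := Tuple.sort f
  obtain ⟨hmono, htie⟩ := Tuple.eq_sort_iff.1 (rfl : σ = Tuple.sort f)
  let S : Finset (Fin n) := Finset.univ.filter fun k => 1 ≤ 2 * z (σ k)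
  have hmem (k : Fin n) : k ∈ S ↔ 1 ≤ 2 * z (σ k) := by simp [S]
  have hσ : stepPerm S = σ := by
    refine stepPerm_eq (fun k l hkl hkS => ?_) fun k l hk hl => ?_
    · by_contra! hle
      have h₁ := hmono hkl.le
      have h₂ := hanti hle
      have h₃ : f (σ k) = f (σ l) := by
        refine le_antisymm h₁ ?_
        rw [hmem, hmem] at hkS
        simp only [f, hkS]
        linarith
      exact (htie k l hkl h₃).not_ge hle
    · rw [hmem] at hk hl
      by_contra! hle
      have := hanti hle
      linarith
  refine ⟨S, fun k => -f (σ k), mem_convexHull_kuhnVertex (fun k l hkl => neg_le_neg (hmono hkl))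
    fun k => ?_, ?_⟩
  · have := hIcc (σ k)
    simp only [f, Set.mem_Icc] at this ⊢
    split_ifs <;> constructor <;> linarith
  · ext j
    obtain ⟨m, rfl⟩ := (stepPerm S).surjective j
    rw [Pi.add_apply, pieceMap_apply_stepPerm, Pi.smul_apply, smul_eq_mul]
    simp only [pivotVertex, kuhnVertex, val_stepPerm, stepIndex_lt_card_iff, hmem, f]
    rw [hσ]
    ring

theorem convexHull_subset_iUnion_freudenthalVertex {n : ℕ} (v : Fin (n + 1) → (Fin n → ℝ)) :
    convexHull ℝ (Set.range v) ⊆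
      ⋃ S : Finset (Fin n), convexHull ℝ (Set.range (freudenthalVertex v S)) := by
  have hv : v = fun k => v 0 + edgeMap v (kuhnVertex k) :=
    funext fun k => (add_edgeMap_kuhnVertex v k).symm
  intro x hx
  rw [hv, convexHull_range_add_linearMap] at hx
  obtain ⟨z, hz, rfl⟩ := hx
  obtain ⟨S, u, hu, rfl⟩ := exists_eq_pivotVertex_add_pieceMap hz
  refine Set.mem_iUnion.2 ⟨S, ?_⟩
  rw [funext (freudenthalVertex_eq v S), convexHull_range_add_linearMap]
  exact ⟨u, hu, by simp [add_assoc]⟩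

theorem affineIndependent_iff_volume_convexHull_ne_zero {n : ℕ} (v : Fin (n + 1) → (Fin n → ℝ)) :
    AffineIndependent ℝ v ↔ volume (convexHull ℝ (Set.range v)) ≠ 0 := by
  have hfin : Module.finrank ℝ (Fin n → ℝ) = n := by simp
  constructor
  · intro hv
    have htop : affineSpan ℝ (Set.range v) = ⊤ :=
      hv.affineSpan_eq_top_iff_card_eq_finrank_add_one.2 (by simp)
    have hint := interior_convexHull_nonempty_iff_affineSpan_eq_top.2 htop
    exact (Measure.measure_pos_of_nonempty_interior volume hint).ne'
  · intro h
    have htop : affineSpan ℝ (Set.range v) = ⊤ := by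
      by_contra hne
      exact h (measure_mono_null (convexHull_subset_affineSpan _)
        (Measure.addHaar_affineSubspace volume _ hne))
    rw [affineIndependent_iff_finrank_vectorSpan_eq ℝ v (Fintype.card_fin _),
      ← direction_affineSpan, htop, AffineSubspace.direction_top, finrank_top, hfin]

theorem measure_inter_eq_zero_of_sum_le {α ι : Type*} [MeasurableSpace α] [Fintype ι]
    {μ : Measure α} {U : ι → Set α} (hU : ∀ i, MeasurableSet (U i))
    (hfin : ∀ i, μ (U i) ≠ ⊤) (hsum : ∑ i, μ (U i) ≤ μ (⋃ i, U i)) {i j : ι} (hij : i ≠ j) :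
    μ (U i ∩ U j) = 0 := by
  classical
  let R : Finset ι := (Finset.univ.erase i).erase j
  have hj : j ∈ Finset.univ.erase i := by simp [hij.symm]
  have hsplit : ∑ k, μ (U k) = (μ (U i) + μ (U j)) + ∑ k ∈ R, μ (U k) := by
    rw [← Finset.add_sum_erase _ _ (Finset.mem_univ i), ← Finset.add_sum_erase _ _ hj, add_assoc]
  have hle : μ (⋃ k, U k) ≤ μ (U i ∪ U j) + ∑ k ∈ R, μ (U k) := by
    refine (measure_mono ?_).trans ((measure_union_le (U i ∪ U j) (⋃ k ∈ R, U k)).trans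
      (add_le_add_right (measure_biUnion_finset_le R U) _))
    intro x hx
    obtain ⟨k, hk⟩ := Set.mem_iUnion.1 hx
    by_cases hki : k = i
    · exact Or.inl (Or.inl (hki ▸ hk))
    by_cases hkj : k = j
    · exact Or.inl (Or.inr (hkj ▸ hk))
    · exact Or.inr (Set.mem_biUnion (by simp [R, hki, hkj]) hk)
  have hR : ∑ k ∈ R, μ (U k) ≠ ⊤ := (ENNReal.sum_lt_top.2 fun k _ => (hfin k).lt_top).ne
  have h := hsum.trans hle
  rw [hsplit, ← measure_union_add_inter (U i) (hU j), add_right_comm] at h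
  have htop : μ (U i ∪ U j) + ∑ k ∈ R, μ (U k) ≠ ⊤ :=
    ENNReal.add_ne_top.2 ⟨measure_union_ne_top (hfin i) (hfin j), hR⟩
  by_contra hne
  exact (ENNReal.lt_add_right htop hne).not_ge h

/-- Existence of the Freudenthal subdivision of a geometric `n`-simplex:
`T = convexHull {v₀,…,vₙ}` splits into `2ⁿ` subsimplices whose vertices are
midpoints of pairs of vertices of `T`, covering `T`, with pairwise disjoint
interiors, each of Lebesgue measure `2⁻ⁿ · volume T`. -/
theorem freudenthal_subdivision_exists
    (n : ℕ) (hn : 1 ≤ n) (v : Fin (n + 1) → (Fin n → ℝ))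
    (hv : AffineIndependent ℝ v) :
    ∃ U : Fin (2 ^ n) → Set (Fin n → ℝ),
      (∀ m, ∃ w : Fin (n + 1) → (Fin n → ℝ),
          AffineIndependent ℝ w ∧
          (∀ i, ∃ a b : Fin (n + 1), w i = midpoint ℝ (v a) (v b)) ∧
          U m = convexHull ℝ (Set.range w)) ∧
      (convexHull ℝ (Set.range v) = ⋃ m, U m) ∧
      (∀ m m', m ≠ m' → interior (U m) ∩ interior (U m') = ∅) ∧
      (∀ m, volume (U m) = volume (convexHull ℝ (Set.range v)) / 2 ^ n) := by
  let e : Fin (2 ^ n) ≃ Finset (Fin n) := (Fintype.equivFinOfCardEq (by simp)).symm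
  let U : Fin (2 ^ n) → Set (Fin n → ℝ) :=
    fun m => convexHull ℝ (Set.range (freudenthalVertex v (e m)))
  have hvol (m) : volume (U m) = volume (convexHull ℝ (Set.range v)) / 2 ^ n :=
    volume_convexHull_freudenthalVertex v (e m)
  have hcover : convexHull ℝ (Set.range v) = ⋃ m, U m := by
    refine Set.Subset.antisymm ?_
      (Set.iUnion_subset fun m => convexHull_freudenthalVertex_subset v (e m))
    rw [e.surjective.iUnion_comp fun S => convexHull ℝ (Set.range (freudenthalVertex v S))]
    exact convexHull_subset_iUnion_freudenthalVertex v
  have hcompact (m) : IsCompact (U m) := (Set.finite_range _).isCompact_convexHull ℝ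
  refine ⟨U, fun m => ⟨freudenthalVertex v (e m), ?_, fun i => ⟨_, _, rfl⟩, rfl⟩, hcover,
    fun m m' hm => ?_, hvol⟩
  · rw [affineIndependent_iff_volume_convexHull_ne_zero] at hv ⊢
    rw [volume_convexHull_freudenthalVertex]
    exact ENNReal.div_ne_zero.2 ⟨hv, by simp⟩
  · have hsum : ∑ m, volume (U m) ≤ volume (⋃ m, U m) := by
      rw [← hcover]
      simp only [hvol, Finset.sum_const, Finset.card_univ, Fintype.card_fin, nsmul_eq_mul,
        Nat.cast_pow, Nat.cast_ofNat]
      exact (ENNReal.mul_div_cancel (by simp) (by simp)).le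
    have hnull := measure_inter_eq_zero_of_sum_le (fun m => (hcompact m).isClosed.measurableSet)
      (fun m => (hcompact m).measure_lt_top.ne) hsum hm
    rw [← interior_inter]
    exact volume.interior_eq_empty_of_null hnull
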